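/- arXiv:math/0410601 — 2 statements merged into one kernel-verified Lean document; each statement's English description precedes it below -/
import Mathlib

section
/- For integers n ≥ 1 and 1 ≤ j ≤ n, the number of noncrossing partitions V of {1,…,n+2} having no singleton blocks, such that 1 and 2 lie in different blocks of V and the second-smallest element of the block of V containing 1 equals j+2, is equal to the product of (the number of noncrossing partitions of {1,…,j} having no singleton blocks) and (the number of noncrossing partitions W of {1,…,n+2−j} having no singleton blocks such that 1 and 2 lie in the same block of W). -/
/-- A finite partition `V` of `{1, …, n}` (modelled as `Fin n` with its natural
order) is noncrossing if there are no `i₁ < j₁ < i₂ < j₂` with `i₁, i₂` in one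
block of `V` and `j₁, j₂` in a different block of `V`. -/
def IsNoncrossing {n : ℕ} (V : Finpartition (Finset.univ : Finset (Fin n))) : Prop :=
  ¬ ∃ i₁ j₁ i₂ j₂ : Fin n, i₁ < j₁ ∧ j₁ < i₂ ∧ i₂ < j₂ ∧
      ∃ B ∈ V.parts, ∃ B' ∈ V.parts, B ≠ B' ∧ i₁ ∈ B ∧ i₂ ∈ B ∧ j₁ ∈ B' ∧ j₂ ∈ B'

namespace Finpartition

variable {α : Type*} [Fintype α] [DecidableEq α]

/-- The equivalence relation "lying in the same part" of a finite partition. -/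
def toSetoid (V : Finpartition (Finset.univ : Finset α)) : Setoid α :=
  Setoid.ker V.part

lemma toSetoid_iff (V : Finpartition (Finset.univ : Finset α)) {a b : α} :
    V.toSetoid a b ↔ V.part a = V.part b := Iff.rfl

lemma mem_part_iff_toSetoid (V : Finpartition (Finset.univ : Finset α)) {a b : α} :
    b ∈ V.part a ↔ V.toSetoid a b := by
  rw [V.mem_part_iff_part_eq_part (Finset.mem_univ _) (Finset.mem_univ _), toSetoid_iff, eq_comm]

lemma exists_part_eq (V : Finpartition (Finset.univ : Finset α)) {B : Finset α}
    (hB : B ∈ V.parts) : ∃ a, V.part a = B := by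
  obtain ⟨a, -, ha⟩ := V.part_surjOn hB
  exact ⟨a, ha⟩

lemma part_mem_parts (V : Finpartition (Finset.univ : Finset α)) (a : α) :
    V.part a ∈ V.parts := V.part_mem.2 (Finset.mem_univ a)

lemma toSetoid_bijective :
    Function.Bijective (toSetoid : Finpartition (Finset.univ : Finset α) → Setoid α) := by
  classical
  constructor
  · intro V W h
    have key : ∀ a, V.part a = W.part a := fun a ↦ by
      ext b
      rw [mem_part_iff_toSetoid, mem_part_iff_toSetoid, h]
    ext B
    constructor
    · intro hB
      obtain ⟨a, rfl⟩ := V.exists_part_eq hB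
      exact key a ▸ W.part_mem_parts a
    · intro hB
      obtain ⟨a, rfl⟩ := W.exists_part_eq hB
      exact key a ▸ V.part_mem_parts a
  · intro s
    refine ⟨ofSetoid s, ?_⟩
    ext a b
    rw [← mem_part_iff_toSetoid, mem_part_ofSetoid_iff_rel]

lemma card_subtype_eq_card_setoid {p : Finpartition (Finset.univ : Finset α) → Prop}
    {q : Setoid α → Prop} (h : ∀ V, p V ↔ q V.toSetoid) :
    Nat.card {V // p V} = Nat.card {s // q s} :=
  Nat.card_congr ((Equiv.ofBijective _ toSetoid_bijective).subtypeEquiv h)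

lemma forall_card_ne_one_iff (V : Finpartition (Finset.univ : Finset α)) :
    (∀ B ∈ V.parts, B.card ≠ 1) ↔ ∀ a, ∃ b, b ≠ a ∧ V.toSetoid a b := by
  constructor
  · intro h a
    by_contra! hc
    refine h _ (V.part_mem_parts a) (Finset.card_eq_one.2 ⟨a, ?_⟩)
    ext b
    rw [mem_part_iff_toSetoid, Finset.mem_singleton]
    refine ⟨fun hb ↦ ?_, fun hb ↦ hb ▸ V.toSetoid.refl _⟩
    by_contra hne
    exact hc b hne hb
  · intro h B hB hcard
    obtain ⟨a, rfl⟩ := Finset.card_eq_one.1 hcard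
    obtain ⟨b, hne, hb⟩ := h a
    rw [← mem_part_iff_toSetoid, V.part_eq_of_mem hB (Finset.mem_singleton_self a),
      Finset.mem_singleton] at hb
    exact hne hb

lemma exists_part_iff (V : Finpartition (Finset.univ : Finset α)) (a : α) (q : Finset α → Prop) :
    (∃ B ∈ V.parts, a ∈ B ∧ q B) ↔ q (V.part a) := by
  constructor
  · rintro ⟨B, hB, ha, hq⟩
    rwa [V.part_eq_of_mem hB ha]
  · exact fun h ↦ ⟨_, V.part_mem_parts a, V.mem_part (Finset.mem_univ a), h⟩

lemma forall_part_iff (V : Finpartition (Finset.univ : Finset α)) (a : α) (q : Finset α → Prop) :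
    (∀ B ∈ V.parts, a ∈ B → q B) ↔ q (V.part a) := by
  constructor
  · exact fun h ↦ h _ (V.part_mem_parts a) (V.mem_part (Finset.mem_univ a))
  · intro h B hB ha
    rwa [← V.part_eq_of_mem hB ha]

end Finpartition

lemma isNoncrossing_iff {n : ℕ} (V : Finpartition (Finset.univ : Finset (Fin n))) :
    IsNoncrossing V ↔ ∀ a b c d : Fin n, a < b → b < c → c < d →
      V.toSetoid a c → V.toSetoid b d → V.toSetoid a b := by
  constructor
  · intro h a b c d hab hbc hcd hac hbd
    by_contra hne
    exact h ⟨a, b, c, d, hab, hbc, hcd, _, V.part_mem_parts a, _, V.part_mem_parts b, hne,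
      V.mem_part (Finset.mem_univ a), V.mem_part_iff_toSetoid.2 hac,
      V.mem_part (Finset.mem_univ b), V.mem_part_iff_toSetoid.2 hbd⟩
  · rintro h ⟨a, b, c, d, hab, hbc, hcd, B, hB, B', hB', hne, ha, hc, hb, hd⟩
    have eq {x : Fin n} {C} (hC : C ∈ V.parts) (hx : x ∈ C) := V.part_eq_of_mem hC hx
    refine hne ?_
    rw [← eq hB ha, ← eq hB' hb]
    exact h a b c d hab hbc hcd ((eq hB ha).trans (eq hB hc).symm)
      ((eq hB' hb).trans (eq hB' hd).symm)

lemma min_erase_eq_coe_iff {α : Type*} [LinearOrder α] {B : Finset α} {a m : α} :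
    (B.erase a).min = (m : WithTop α) ↔ (m ∈ B ∧ m ≠ a) ∧ ∀ b ∈ B, b ≠ a → m ≤ b := by
  constructor
  · intro h
    have hm := Finset.mem_of_min h
    exact ⟨(Finset.mem_erase.1 hm).symm,
      fun b hb hne ↦ Finset.min_le_of_eq (Finset.mem_erase.2 ⟨hne, hb⟩) h⟩
  · rintro ⟨⟨hm, hne⟩, h⟩
    refine le_antisymm (Finset.min_le (Finset.mem_erase.2 ⟨hne, hm⟩)) (Finset.le_min fun b hb ↦ ?_)
    exact WithTop.coe_le_coe.2 (h b (Finset.mem_erase.1 hb).2 (Finset.mem_erase.1 hb).1)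

namespace Setoid

/-- No two distinct classes of an equivalence relation on a linear order cross. -/
def Noncrossing {α : Type*} [LT α] (s : Setoid α) : Prop :=
  ∀ a b c d : α, a < b → b < c → c < d → s a c → s b d → s a b

/-- An equivalence relation has no singleton classes. -/
def NoSingleton {α : Type*} (s : Setoid α) : Prop :=
  ∀ a, ∃ b, b ≠ a ∧ s a b

/-- The sum of two equivalence relations, transported along `e`: it restricts to `s` and `t` on the
two summands and relates no element of the first summand to an element of the second. -/
def glue {α β γ : Type*} (e : α ≃ β ⊕ γ) (s : Setoid β) (t : Setoid γ) : Setoid α where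
  r x y := Sum.LiftRel s t (e x) (e y)
  iseqv := by
    refine ⟨fun x ↦ ?_, fun {x y} h ↦ ?_, fun {x y z} h h' ↦ ?_⟩
    · cases e x
      · exact .inl (s.refl _)
      · exact .inr (t.refl _)
    · generalize e x = u at h ⊢
      generalize e y = v at h ⊢
      cases h with
      | inl h => exact .inl (s.symm h)
      | inr h => exact .inr (t.symm h)
    · generalize e x = u at h ⊢
      generalize e y = v at h h' ⊢
      generalize e z = w at h' ⊢
      cases h with
      | inl h => cases h' with | inl h' => exact .inl (s.trans h h')
      | inr h => cases h' with | inr h' => exact .inr (t.trans h h')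

lemma glue_symm_iff {α β γ : Type*} {e : α ≃ β ⊕ γ} {s : Setoid β} {t : Setoid γ} {u v : β ⊕ γ} :
    glue e s t (e.symm u) (e.symm v) ↔ Sum.LiftRel s t u v := by
  change Sum.LiftRel _ _ _ _ ↔ _
  rw [e.apply_symm_apply, e.apply_symm_apply]

lemma NoSingleton.glue {α β γ : Type*} {e : α ≃ β ⊕ γ} {s : Setoid β} {t : Setoid γ}
    (hs : s.NoSingleton) (ht : t.NoSingleton) : (glue e s t).NoSingleton := by
  intro x
  obtain ⟨a | a, rfl⟩ := e.symm.surjective x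
  · obtain ⟨b, hne, hb⟩ := hs a
    exact ⟨e.symm (.inl b), by simpa using hne, glue_symm_iff.2 (.inl hb)⟩
  · obtain ⟨b, hne, hb⟩ := ht a
    exact ⟨e.symm (.inr b), by simpa using hne, glue_symm_iff.2 (.inr hb)⟩

lemma Noncrossing.comap {α β : Type*} [Preorder α] [Preorder β] {s : Setoid α}
    (hs : s.Noncrossing) {f : β → α} (hf : StrictMono f) : (s.comap f).Noncrossing :=
  fun _ _ _ _ hab hbc hcd hac hbd ↦ hs _ _ _ _ (hf hab) (hf hbc) (hf hcd) hac hbd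

end Setoid

/-- The equivalence splitting `{0, …, n + 1}` into the interval `{1, …, j}` and its complement,
both relabelled increasingly. -/
def intervalSplit (n j : ℕ) (hjn : j ≤ n) : Fin (n + 2) ≃ Fin j ⊕ Fin (n + 2 - j) where
  toFun x :=
    if h0 : x.1 = 0 then .inr ⟨0, by omega⟩
    else if hj : x.1 ≤ j then .inl ⟨x.1 - 1, by omega⟩
    else .inr ⟨x.1 - j, by omega⟩
  invFun := Sum.elim (fun a ↦ ⟨a.1 + 1, by omega⟩)
    (fun a ↦ ⟨if a.1 = 0 then 0 else a.1 + j, by split <;> omega⟩)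
  left_inv x := by
    dsimp only
    split_ifs <;> ext <;> simp <;> grind
  right_inv y := by
    rcases y with a | a
    · simp
    · rcases a with ⟨_ | a, ha⟩
      · simp
      · have : a + 1 + j ≠ 0 ∧ ¬ a + 1 + j ≤ j := by omega
        simp [this]

@[simp]
lemma intervalSplit_symm_inl_val {n j : ℕ} (hjn : j ≤ n) (a : Fin j) :
    ((intervalSplit n j hjn).symm (.inl a)).1 = a.1 + 1 := rfl

@[simp]
lemma intervalSplit_symm_inr_val {n j : ℕ} (hjn : j ≤ n) (a : Fin (n + 2 - j)) :
    ((intervalSplit n j hjn).symm (.inr a)).1 = if a.1 = 0 then 0 else a.1 + j := rfl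

lemma strictMono_intervalSplit_symm_inl {n j : ℕ} (hjn : j ≤ n) :
    StrictMono fun a ↦ (intervalSplit n j hjn).symm (.inl a) :=
  fun _ _ hab ↦ Fin.lt_def.2 (Nat.succ_lt_succ hab)

lemma strictMono_intervalSplit_symm_inr {n j : ℕ} (hjn : j ≤ n) :
    StrictMono fun a ↦ (intervalSplit n j hjn).symm (.inr a) := by
  intro a b hab
  simp only [Fin.lt_def, intervalSplit_symm_inr_val] at hab ⊢
  split_ifs <;> omega

namespace Setoid

variable {n j : ℕ}

/-- `0` is related to `j + 1` and to nothing strictly between. -/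
def SecondAt (j : ℕ) (s : Setoid (Fin (n + 2))) : Prop :=
  ∀ x y : Fin (n + 2), x.1 = 0 → y.1 ≤ j + 1 → (s x y ↔ y.1 = 0 ∨ y.1 = j + 1)

/-- The first two points are related. -/
def FirstTwo {m : ℕ} (t : Setoid (Fin m)) : Prop :=
  ∀ x y : Fin m, x.1 = 0 → y.1 = 1 → t x y

lemma Noncrossing.not_rel_symm_inl_inr {s : Setoid (Fin (n + 2))} (hjn : j ≤ n)
    (hs : s.Noncrossing) (h : s.SecondAt j) (a : Fin j) (b : Fin (n + 2 - j)) :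
    ¬ s ((intervalSplit n j hjn).symm (.inl a)) ((intervalSplit n j hjn).symm (.inr b)) := by
  intro hab
  have hx := intervalSplit_symm_inl_val hjn a
  have hy := intervalSplit_symm_inr_val hjn b
  set x := (intervalSplit n j hjn).symm (.inl a)
  set y := (intervalSplit n j hjn).symm (.inr b)
  have h0x : ¬ s ⟨0, by omega⟩ x := by
    rw [h _ x rfl (by omega)]
    omega
  have h0m : s ⟨0, by omega⟩ ⟨j + 1, by omega⟩ := by
    rw [h _ _ rfl le_rfl]
    exact .inr rfl
  by_cases hyj : y.1 ≤ j + 1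
  · refine h0x (s.trans ((h _ y rfl hyj).2 ?_) (s.symm hab))
    split_ifs at hy <;> omega
  · exact h0x (hs _ x ⟨j + 1, by omega⟩ y (Fin.lt_def.2 (by simp [hx]))
      (Fin.lt_def.2 (by simp [hx])) (Fin.lt_def.2 (by simpa using hyj)) h0m hab)

lemma glue_comap_of_noncrossing {s : Setoid (Fin (n + 2))} (hjn : j ≤ n)
    (hs : s.Noncrossing) (h : s.SecondAt j) :
    glue (intervalSplit n j hjn) (s.comap fun a ↦ (intervalSplit n j hjn).symm (.inl a))
      (s.comap fun a ↦ (intervalSplit n j hjn).symm (.inr a)) = s := by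
  ext x y
  obtain ⟨u, rfl⟩ := (intervalSplit n j hjn).symm.surjective x
  obtain ⟨v, rfl⟩ := (intervalSplit n j hjn).symm.surjective y
  rw [glue_symm_iff]
  rcases u with a | a <;> rcases v with b | b
  · simp [Setoid.comap_rel]
  · simpa using hs.not_rel_symm_inl_inr hjn h a b
  · simpa using fun hba ↦ hs.not_rel_symm_inl_inr hjn h b a (s.symm hba)
  · simp [Setoid.comap_rel]

lemma Noncrossing.glue {s : Setoid (Fin j)} {t : Setoid (Fin (n + 2 - j))} (hjn : j ≤ n)
    (hs : s.Noncrossing) (ht : t.Noncrossing) :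
    (glue (intervalSplit n j hjn) s t).Noncrossing := by
  intro x y z w hxy hyz hzw hxz hyw
  obtain ⟨x, rfl⟩ := (intervalSplit n j hjn).symm.surjective x
  obtain ⟨y, rfl⟩ := (intervalSplit n j hjn).symm.surjective y
  obtain ⟨z, rfl⟩ := (intervalSplit n j hjn).symm.surjective z
  obtain ⟨w, rfl⟩ := (intervalSplit n j hjn).symm.surjective w
  rw [glue_symm_iff] at hxz hyw ⊢
  have hl {a b} := (strictMono_intervalSplit_symm_inl hjn).lt_iff_lt (a := a) (b := b)
  have hr {a b} := (strictMono_intervalSplit_symm_inr hjn).lt_iff_lt (a := a) (b := b)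
  cases hxz with
  | @inl a c hac =>
    cases hyw with
    | @inl b d hbd => exact .inl (hs _ _ _ _ (hl.1 hxy) (hl.1 hyz) (hl.1 hzw) hac hbd)
    | @inr b d hbd =>
      simp only [Fin.lt_def, intervalSplit_symm_inl_val, intervalSplit_symm_inr_val] at hxy hyz
      split_ifs at hxy hyz <;> omega
  | @inr a c hac =>
    cases hyw with
    | @inl b d hbd =>
      simp only [Fin.lt_def, intervalSplit_symm_inl_val, intervalSplit_symm_inr_val] at hyz hzw
      split_ifs at hyz hzw <;> omega
    | @inr b d hbd => exact .inr (ht _ _ _ _ (hr.1 hxy) (hr.1 hyz) (hr.1 hzw) hac hbd)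

lemma FirstTwo.secondAt_glue {s : Setoid (Fin j)} {t : Setoid (Fin (n + 2 - j))} (hjn : j ≤ n)
    (ht : t.FirstTwo) : (glue (intervalSplit n j hjn) s t).SecondAt j := by
  intro x y hx hy
  obtain ⟨u, rfl⟩ := (intervalSplit n j hjn).symm.surjective x
  obtain ⟨v, rfl⟩ := (intervalSplit n j hjn).symm.surjective y
  rw [glue_symm_iff]
  rcases u with a | a
  · simp at hx
  have ha : a.1 = 0 := by
    rw [intervalSplit_symm_inr_val] at hx
    split_ifs at hx <;> omega
  rcases v with b | b
  · simp
    omega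
  · rw [intervalSplit_symm_inr_val] at hy ⊢
    rw [Sum.liftRel_inr_inr]
    split_ifs at hy ⊢ with hb
    · simp [Fin.ext (ha.trans hb.symm)]
    · exact iff_of_true (ht a b ha (by omega)) (by omega)

lemma NoSingleton.of_glue {α β γ : Type*} {e : α ≃ β ⊕ γ} {s : Setoid β} {t : Setoid γ}
    (h : (Setoid.glue e s t).NoSingleton) : s.NoSingleton ∧ t.NoSingleton := by
  constructor
  · intro a
    obtain ⟨y, hne, hy⟩ := h (e.symm (.inl a))
    obtain ⟨b | b, rfl⟩ := e.symm.surjective y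
    · exact ⟨b, by simpa using hne, by simpa [glue_symm_iff] using hy⟩
    · simp [glue_symm_iff] at hy
  · intro a
    obtain ⟨y, hne, hy⟩ := h (e.symm (.inr a))
    obtain ⟨b | b, rfl⟩ := e.symm.surjective y
    · simp [glue_symm_iff] at hy
    · exact ⟨b, by simpa using hne, by simpa [glue_symm_iff] using hy⟩

/-- A noncrossing relation in which `0` is next related to `j + 1` is the same as a noncrossing
relation on the interval `{1, …, j}` together with one on its complement. -/
def noncrossingSplit (hjn : j ≤ n) :
    {s : Setoid (Fin (n + 2)) // s.Noncrossing ∧ s.NoSingleton ∧ s.SecondAt j} ≃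
      {s : Setoid (Fin j) // s.Noncrossing ∧ s.NoSingleton} ×
      {t : Setoid (Fin (n + 2 - j)) // t.Noncrossing ∧ t.NoSingleton ∧ t.FirstTwo} where
  toFun s :=
    have hns := NoSingleton.of_glue ((glue_comap_of_noncrossing hjn s.2.1 s.2.2.2).symm ▸ s.2.2.1)
    ⟨⟨_, s.2.1.comap (strictMono_intervalSplit_symm_inl hjn), hns.1⟩,
      ⟨_, s.2.1.comap (strictMono_intervalSplit_symm_inr hjn), hns.2, fun x y hx hy ↦
        (s.2.2.2 _ _ (by simp [hx]) (by simp [hy]; omega)).2 (.inr (by simp [hy]; omega))⟩⟩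
  invFun p := ⟨glue (intervalSplit n j hjn) p.1.1 p.2.1, p.1.2.1.glue hjn p.2.2.1,
    p.1.2.2.glue p.2.2.2.1, p.2.2.2.2.secondAt_glue hjn⟩
  left_inv s := Subtype.ext (glue_comap_of_noncrossing hjn s.2.1 s.2.2.2)
  right_inv p := by
    refine Prod.ext (Subtype.ext ?_) (Subtype.ext ?_) <;> ext a b
    · exact glue_symm_iff.trans Sum.liftRel_inl_inl
    · exact glue_symm_iff.trans Sum.liftRel_inr_inr

end Setoid

/-- **Decomposition of noncrossing partitions separating the first two points.**
Modelling `{1, …, n+2}` as `Fin (n+2)` (so that the elements `1`, `2`, `j+2`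
correspond to `0`, `1`, `j+1`), the number of noncrossing partitions of
`{1, …, n+2}` with no singleton blocks separating `1` from `2`, such that the
second-smallest element of the block containing `1` is `j+2`, equals the number
of noncrossing partitions of `{1, …, j}` with no singleton blocks times the
number of noncrossing partitions of `{1, …, n+2-j}` with no singleton blocks in
which `1` and `2` lie in the same block. -/
theorem stmt_16 (n j : ℕ) (hn : 1 ≤ n) (hj1 : 1 ≤ j) (hjn : j ≤ n) :
    Nat.card {V : Finpartition (Finset.univ : Finset (Fin (n + 2))) //
        IsNoncrossing V ∧ (∀ B ∈ V.parts, B.card ≠ 1) ∧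
        (∀ B ∈ V.parts, (0 : Fin (n + 2)) ∈ B → (1 : Fin (n + 2)) ∉ B) ∧
        (∃ B ∈ V.parts, (0 : Fin (n + 2)) ∈ B ∧
          (B.erase 0).min = ((⟨j + 1, by omega⟩ : Fin (n + 2)) : WithTop (Fin (n + 2))))} =
      Nat.card {W : Finpartition (Finset.univ : Finset (Fin j)) //
          IsNoncrossing W ∧ ∀ B ∈ W.parts, B.card ≠ 1} *
      Nat.card {W : Finpartition (Finset.univ : Finset (Fin (n + 2 - j))) //
          IsNoncrossing W ∧ (∀ B ∈ W.parts, B.card ≠ 1) ∧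
          ∃ B ∈ W.parts, (⟨0, by omega⟩ : Fin (n + 2 - j)) ∈ B ∧
            (⟨1, by omega⟩ : Fin (n + 2 - j)) ∈ B} := by
  rw [Finpartition.card_subtype_eq_card_setoid
      (q := fun s ↦ s.Noncrossing ∧ s.NoSingleton ∧ s.SecondAt j),
    Finpartition.card_subtype_eq_card_setoid (q := fun s ↦ s.Noncrossing ∧ s.NoSingleton),
    Finpartition.card_subtype_eq_card_setoid
      (q := fun t ↦ t.Noncrossing ∧ t.NoSingleton ∧ t.FirstTwo),
    Nat.card_congr (Setoid.noncrossingSplit hjn), Nat.card_prod]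
  · intro W
    rw [isNoncrossing_iff, W.forall_card_ne_one_iff, W.exists_part_iff, W.mem_part_iff_toSetoid]
    refine and_congr_right fun _ ↦ and_congr_right fun _ ↦ ⟨fun h x y hx hy ↦ ?_, fun h ↦ ?_⟩
    · convert h
    · exact h _ _ rfl rfl
  · intro W
    rw [isNoncrossing_iff, W.forall_card_ne_one_iff]
    rfl
  · intro V
    rw [isNoncrossing_iff, V.forall_card_ne_one_iff, V.exists_part_iff, V.forall_part_iff,
      min_erase_eq_coe_iff]
    simp only [V.mem_part_iff_toSetoid]
    refine and_congr_right fun _ ↦ and_congr_right fun _ ↦ ⟨?_, fun h ↦ ?_⟩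
    · rintro ⟨-, ⟨hm, -⟩, hmin⟩ x y hx hy
      obtain rfl : x = 0 := Fin.ext hx
      constructor
      · intro hxy
        by_cases hy0 : y = 0
        · simp [hy0]
        · exact .inr (le_antisymm hy (hmin y hxy hy0))
      · rintro (hy0 | hyj)
        · obtain rfl : y = 0 := Fin.ext hy0
          exact V.toSetoid.refl _
        · convert hm
    · refine ⟨?_, ⟨(h _ _ rfl le_rfl).2 (.inr rfl), by simp [Fin.ext_iff]⟩, fun b hb hne ↦ ?_⟩
      · rw [h 0 1 rfl (by simp)]
        simp
        omega
      · by_contra! hlt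
        have hlt' : b.1 < j + 1 := hlt
        rcases (h 0 b rfl hlt'.le).1 hb with h0 | h0
        · exact hne (Fin.ext h0)
        · omega
end

section
/- For every integer m ≥ 0 and every a ∈ ℝ, Σ_{V ∈ NC_{≤2}(m)} (2a)^{s(V)}·(a²)^{|V| − s(V)} = (1/(m+2))·binom(2m+2, m+1)·a^m, the sum being over all noncrossing partitions of {1,…,m} whose blocks have size at most 2, where s(V) is the number of singleton blocks and |V| the number of blocks of V. Equivalently, the free cumulants of the standardized free Gamma type law μ_{2a,a²} are R_{k+1} = (1/(k+1))·binom(2k, k)·a^{k−1} for k ≥ 1. -/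
/-- The number of singleton blocks of a finite partition. -/
def singletonCount {n : ℕ} (V : Finpartition (Finset.univ : Finset (Fin n))) : ℕ :=
  (V.parts.filter fun B => B.card = 1).card

/-- A finite set of arcs `(i, j)` with `a ≤ i < j < b`, any two of which are disjoint or nested. -/
def IsArcDiagram (a b : ℕ) (A : Finset (ℕ × ℕ)) : Prop :=
  (∀ p ∈ A, a ≤ p.1 ∧ p.1 < p.2 ∧ p.2 < b) ∧
    ∀ p ∈ A, ∀ q ∈ A, p = q ∨ p.2 < q.1 ∨ q.2 < p.1 ∨
      (p.1 < q.1 ∧ q.2 < p.2) ∨ (q.1 < p.1 ∧ p.2 < q.2)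

open Classical in
/-- The arc diagrams on the interval `[a, b)`. -/
noncomputable def arcDiagrams (a b : ℕ) : Finset (Finset (ℕ × ℕ)) :=
  (Finset.Ico a b ×ˢ Finset.Ico a b).powerset.filter (IsArcDiagram a b)

theorem mem_arcDiagrams {a b : ℕ} {A : Finset (ℕ × ℕ)} :
    A ∈ arcDiagrams a b ↔ IsArcDiagram a b A := by
  classical
  rw [arcDiagrams, Finset.mem_filter, Finset.mem_powerset, and_iff_right_iff_imp]
  intro h p hp
  have := h.1 p hp
  simp only [Finset.mem_product, Finset.mem_Ico]
  omega

/-- The weighted count of arc diagrams on `[a, b)`, each free point having weight `2`. -/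
noncomputable def arcDiagramSum (a b : ℕ) : ℝ :=
  ∑ A ∈ arcDiagrams a b, 2 ^ (b - a) * (1 / 4) ^ A.card

theorem arcDiagramSum_of_le {a b : ℕ} (h : b ≤ a) : arcDiagramSum a b = 1 := by
  have : arcDiagrams a b = {∅} := by
    ext A
    rw [mem_arcDiagrams, Finset.mem_singleton]
    constructor
    · intro hA
      refine Finset.eq_empty_of_forall_notMem fun p hp => ?_
      have := hA.1 p hp
      omega
    · rintro rfl
      simp [IsArcDiagram]
  simp [arcDiagramSum, this, Nat.sub_eq_zero_of_le h]

theorem IsArcDiagram.mono {a b a' b' : ℕ} {A B : Finset (ℕ × ℕ)} (h : IsArcDiagram a b A)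
    (hB : B ⊆ A) (hab : ∀ p ∈ B, a' ≤ p.1 ∧ p.2 < b') : IsArcDiagram a' b' B :=
  ⟨fun p hp => ⟨(hab p hp).1, (h.1 p (hB hp)).2.1, (hab p hp).2⟩,
    fun p hp q hq => h.2 p (hB hp) q (hB hq)⟩

theorem IsArcDiagram.insert_union {a b k : ℕ} {A B : Finset (ℕ × ℕ)} (hak : a < k) (hkb : k < b)
    (hA : IsArcDiagram (a + 1) k A) (hB : IsArcDiagram (k + 1) b B) :
    IsArcDiagram a b (insert (a, k) (A ∪ B)) := by
  constructor
  · intro p hp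
    rw [Finset.mem_insert, Finset.mem_union] at hp
    rcases hp with rfl | hp | hp
    · dsimp only; omega
    · have := hA.1 p hp; omega
    · have := hB.1 p hp; omega
  · intro p hp q hq
    rw [Finset.mem_insert, Finset.mem_union] at hp hq
    rcases hp with rfl | hp | hp <;> rcases hq with rfl | hq | hq
    · exact Or.inl rfl
    · have := hA.1 q hq; dsimp only; omega
    · have := hB.1 q hq; dsimp only; omega
    · have := hA.1 p hp; dsimp only; omega
    · exact hA.2 p hp q hq
    · have := hA.1 p hp; have := hB.1 q hq; omega
    · have := hB.1 p hp; dsimp only; omega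
    · have := hB.1 p hp; have := hA.1 q hq; omega
    · exact hB.2 p hp q hq

theorem filter_insert_union_left {a b k : ℕ} {A B : Finset (ℕ × ℕ)}
    (hA : IsArcDiagram (a + 1) k A) (hB : IsArcDiagram (k + 1) b B) :
    (insert (a, k) (A ∪ B)).filter (fun p => p.2 < k) = A := by
  ext p
  rw [Finset.mem_filter, Finset.mem_insert, Finset.mem_union]
  constructor
  · rintro ⟨rfl | hp | hp, h⟩
    · dsimp only at h; omega
    · exact hp
    · have := hB.1 p hp; omega
  · intro hp
    exact ⟨Or.inr (Or.inl hp), (hA.1 p hp).2.2⟩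

theorem filter_insert_union_right {a b k : ℕ} {A B : Finset (ℕ × ℕ)} (hak : a < k)
    (hA : IsArcDiagram (a + 1) k A) (hB : IsArcDiagram (k + 1) b B) :
    (insert (a, k) (A ∪ B)).filter (fun p => k < p.1) = B := by
  ext p
  rw [Finset.mem_filter, Finset.mem_insert, Finset.mem_union]
  constructor
  · rintro ⟨rfl | hp | hp, h⟩
    · dsimp only at h; omega
    · have := hA.1 p hp; omega
    · exact hp
  · intro hp
    exact ⟨Or.inr (Or.inr hp), (hB.1 p hp).1⟩

theorem card_insert_union {a b k : ℕ} {A B : Finset (ℕ × ℕ)}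
    (hA : IsArcDiagram (a + 1) k A) (hB : IsArcDiagram (k + 1) b B) :
    (insert (a, k) (A ∪ B)).card = A.card + B.card + 1 := by
  rw [Finset.card_insert_of_notMem, Finset.card_union_of_disjoint]
  · rw [Finset.disjoint_left]
    intro p hp hq
    have := hA.1 p hp
    have := hB.1 p hq
    omega
  · rw [Finset.mem_union]
    rintro (hp | hp)
    · have := hA.1 _ hp; dsimp only at this; omega
    · have := hB.1 _ hp; dsimp only at this; omega

theorem IsArcDiagram.eq_insert_union {a b k : ℕ} {A : Finset (ℕ × ℕ)} (h : IsArcDiagram a b A)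
    (hk : (a, k) ∈ A) :
    insert (a, k) (A.filter (fun p => p.2 < k) ∪ A.filter (fun p => k < p.1)) = A := by
  ext p
  simp only [Finset.mem_insert, Finset.mem_union, Finset.mem_filter]
  constructor
  · rintro (rfl | hp | hp)
    exacts [hk, hp.1, hp.1]
  · intro hp
    have h1 := h.1 p hp
    rcases h.2 p hp _ hk with h2 | h2
    · exact Or.inl h2
    · dsimp only at h2
      have : p.2 < k ∨ k < p.1 := by omega
      tauto

theorem arcDiagramSum_succ {a b : ℕ} (hab : a < b) :
    arcDiagramSum a b = 2 * arcDiagramSum (a + 1) b +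
      ∑ k ∈ Finset.Ioo a b, arcDiagramSum (a + 1) k * arcDiagramSum (k + 1) b := by
  classical
  rw [arcDiagramSum, ← Finset.sum_filter_add_sum_filter_not _ (fun A => ∀ p ∈ A, p.1 ≠ a)]
  congr 1
  · have : (arcDiagrams a b).filter (fun A => ∀ p ∈ A, p.1 ≠ a) = arcDiagrams (a + 1) b := by
      ext A
      rw [Finset.mem_filter, mem_arcDiagrams, mem_arcDiagrams]
      constructor
      · rintro ⟨h, h'⟩
        refine h.mono subset_rfl fun p hp => ?_
        have := h.1 p hp
        have := h' p hp
        omega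
      · intro h
        refine ⟨h.mono subset_rfl fun p hp => ?_, fun p hp => ?_⟩ <;>
        · have := h.1 p hp
          omega
    rw [this, arcDiagramSum, Finset.mul_sum]
    refine Finset.sum_congr rfl fun A _ => ?_
    rw [show b - a = b - (a + 1) + 1 by omega, pow_succ]
    ring
  · simp_rw [arcDiagramSum, Finset.sum_mul_sum, ← Finset.sum_product']
    rw [Finset.sum_sigma']
    symm
    refine Finset.sum_bij (fun x _ => insert (a, x.1) (x.2.1 ∪ x.2.2)) ?_ ?_ ?_ ?_
    · rintro ⟨k, A, B⟩ hx
      simp only [Finset.mem_sigma, Finset.mem_Ioo, Finset.mem_product, mem_arcDiagrams] at hx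
      rw [Finset.mem_filter, mem_arcDiagrams]
      refine ⟨hx.2.1.insert_union hx.1.1 hx.1.2 hx.2.2, fun h => ?_⟩
      exact h (a, k) (Finset.mem_insert_self _ _) rfl
    · rintro ⟨k, A, B⟩ hx ⟨l, A', B'⟩ hx' he
      simp only [Finset.mem_sigma, Finset.mem_Ioo, Finset.mem_product, mem_arcDiagrams] at hx hx'
      dsimp only at he
      obtain rfl : k = l := by
        have hk : (a, k) ∈ insert (a, l) (A' ∪ B') := he ▸ Finset.mem_insert_self _ _
        rw [Finset.mem_insert, Finset.mem_union] at hk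
        rcases hk with hk | hk | hk
        · exact (Prod.mk.inj hk).2
        · have := hx'.2.1.1 _ hk; dsimp only at this; omega
        · have := hx'.2.2.1 _ hk; dsimp only at this; omega
      obtain rfl : A = A' := by
        rw [← filter_insert_union_left hx.2.1 hx.2.2, he,
          filter_insert_union_left hx'.2.1 hx'.2.2]
      obtain rfl : B = B' := by
        rw [← filter_insert_union_right hx.1.1 hx.2.1 hx.2.2, he,
          filter_insert_union_right hx.1.1 hx'.2.1 hx'.2.2]
      rfl
    · intro A hA
      rw [Finset.mem_filter, mem_arcDiagrams] at hA
      obtain ⟨hA, h⟩ := hA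
      push Not at h
      obtain ⟨⟨a', k⟩, hp, rfl⟩ := h
      have hk := hA.1 _ hp
      dsimp only at hk hp ⊢
      refine ⟨⟨k, A.filter (fun p => p.2 < k), A.filter (fun p => k < p.1)⟩, ?_,
        hA.eq_insert_union hp⟩
      simp only [Finset.mem_sigma, Finset.mem_Ioo, Finset.mem_product, mem_arcDiagrams]
      refine ⟨hk.2, hA.mono (Finset.filter_subset _ _) fun p hp' => ?_,
        hA.mono (Finset.filter_subset _ _) fun p hp' => ?_⟩
      · rw [Finset.mem_filter] at hp'
        have h1 := hA.1 p hp'.1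
        rcases hA.2 p hp'.1 _ hp with rfl | h2
        · dsimp only at hp'; omega
        · dsimp only at h2; omega
      · rw [Finset.mem_filter] at hp'
        have h1 := hA.1 p hp'.1
        omega
    · rintro ⟨k, A, B⟩ hx
      simp only [Finset.mem_sigma, Finset.mem_Ioo, Finset.mem_product, mem_arcDiagrams] at hx
      dsimp only
      rw [card_insert_union hx.2.1 hx.2.2,
        show b - a = (k - (a + 1)) + (b - (k + 1)) + 2 by omega]
      ring

theorem arcDiagramSum_eq_catalan (a n : ℕ) :
    arcDiagramSum a (a + n) = catalan (n + 1) := by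
  induction n using Nat.strong_induction_on generalizing a with
  | _ n ih =>
    cases n with
    | zero => simp [arcDiagramSum_of_le]
    | succ n =>
      rw [arcDiagramSum_succ (by omega), show a + (n + 1) = a + 1 + n by ring,
        ih n (by omega)]
      have hsum : ∑ k ∈ Finset.Ioo a (a + 1 + n),
          arcDiagramSum (a + 1) k * arcDiagramSum (k + 1) (a + 1 + n) =
          ∑ i ∈ Finset.range n, (catalan (i + 1) : ℝ) * catalan (n - i) := by
        rw [show Finset.Ioo a (a + 1 + n) = Finset.Ico (a + 1) (a + 1 + n) from rfl,
          Finset.sum_Ico_eq_sum_range, show a + 1 + n - (a + 1) = n by omega]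
        refine Finset.sum_congr rfl fun i hi => ?_
        rw [Finset.mem_range] at hi
        rw [ih i (by omega), show a + 1 + n = a + 1 + i + 1 + (n - i - 1) by omega,
          ih (n - i - 1) (by omega), show n - i - 1 + 1 = n - i by omega]
      rw [hsum, catalan_succ (n + 1), Fin.sum_univ_eq_sum_range
        (fun i => catalan i * catalan (n + 1 - i)) (n + 2), Finset.sum_range_succ,
        Finset.sum_range_succ']
      simp only [Nat.add_sub_add_right, Nat.sub_self, catalan_zero, Nat.sub_zero]
      push_cast
      ring

open Classical in
/-- The pairs `(i, j)` with `i < j` lying in a common block of `V`. -/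
noncomputable def blockPairs {m : ℕ} (V : Finpartition (Finset.univ : Finset (Fin m))) :
    Finset (Fin m × Fin m) :=
  Finset.univ.filter fun p => p.1 < p.2 ∧ V.part p.1 = V.part p.2

theorem mem_blockPairs {m : ℕ} {V : Finpartition (Finset.univ : Finset (Fin m))}
    {p : Fin m × Fin m} : p ∈ blockPairs V ↔ p.1 < p.2 ∧ V.part p.1 = V.part p.2 := by
  simp [blockPairs]

/-- The arcs joining the elements of each block of `V`, as pairs of natural numbers. -/
noncomputable def partitionArcs {m : ℕ} (V : Finpartition (Finset.univ : Finset (Fin m))) :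
    Finset (ℕ × ℕ) :=
  (blockPairs V).map (Fin.valEmbedding.prodMap Fin.valEmbedding)

theorem mem_partitionArcs {m : ℕ} {V : Finpartition (Finset.univ : Finset (Fin m))}
    {p : ℕ × ℕ} : p ∈ partitionArcs V ↔
      ∃ i j : Fin m, i < j ∧ V.part i = V.part j ∧ ((i : ℕ), (j : ℕ)) = p := by
  simp [partitionArcs, mem_blockPairs, and_assoc]

theorem Finpartition.mem_part_univ {m : ℕ} (V : Finpartition (Finset.univ : Finset (Fin m)))
    {i j : Fin m} : i ∈ V.part j ↔ V.part i = V.part j :=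
  V.mem_part_iff_part_eq_part (Finset.mem_univ _) (Finset.mem_univ _)

theorem eq_of_part_eq_of_card_le_two {m : ℕ}
    {V : Finpartition (Finset.univ : Finset (Fin m))} (hV : ∀ B ∈ V.parts, B.card ≤ 2)
    {i j k l : Fin m} (hij : i < j) (hkl : k < l) (h1 : V.part i = V.part j)
    (h2 : V.part k = V.part l) (h3 : V.part i = V.part k) : i = k ∧ j = l := by
  have hc := hV (V.part i) (V.part_mem.2 (Finset.mem_univ _))
  have hsub : ({i, j} : Finset (Fin m)) ⊆ V.part i := by
    intro x hx
    rw [Finset.mem_insert, Finset.mem_singleton] at hx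
    rw [V.mem_part_univ]
    rcases hx with rfl | rfl
    exacts [rfl, h1.symm]
  have heq := Finset.eq_of_subset_of_card_le hsub (by rw [Finset.card_pair hij.ne]; exact hc)
  have hk : k ∈ ({i, j} : Finset (Fin m)) := by rw [heq, V.mem_part_univ, h3]
  have hl : l ∈ ({i, j} : Finset (Fin m)) := by rw [heq, V.mem_part_univ, h3, h2]
  rw [Finset.mem_insert, Finset.mem_singleton] at hk hl
  omega

theorem isArcDiagram_partitionArcs {m : ℕ}
    {V : Finpartition (Finset.univ : Finset (Fin m))} (hN : IsNoncrossing V)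
    (hV : ∀ B ∈ V.parts, B.card ≤ 2) : IsArcDiagram 0 m (partitionArcs V) := by
  have hcross : ∀ i j k l : Fin m, V.part i = V.part j → V.part k = V.part l →
      V.part i ≠ V.part k → ¬ (i < k ∧ k < j ∧ j < l) := by
    rintro i j k l h1 h2 hne ⟨hik, hkj, hjl⟩
    refine hN ⟨i, k, j, l, hik, hkj, hjl, V.part i, V.part_mem.2 (Finset.mem_univ _),
      V.part k, V.part_mem.2 (Finset.mem_univ _), hne, ?_⟩
    simp only [V.mem_part_univ]
    exact ⟨trivial, h1.symm, trivial, h2.symm⟩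
  constructor
  · intro p hp
    obtain ⟨i, j, hij, -, rfl⟩ := mem_partitionArcs.1 hp
    dsimp only
    omega
  · intro p hp q hq
    obtain ⟨i, j, hij, h1, rfl⟩ := mem_partitionArcs.1 hp
    obtain ⟨k, l, hkl, h2, rfl⟩ := mem_partitionArcs.1 hq
    by_cases h3 : V.part i = V.part k
    · obtain ⟨rfl, rfl⟩ := eq_of_part_eq_of_card_le_two hV hij hkl h1 h2 h3
      exact Or.inl rfl
    · have c1 := hcross i j k l h1 h2 h3
      have c2 := hcross k l i j h2 h1 (Ne.symm h3)
      have n1 : i ≠ k := fun h => h3 (h ▸ rfl)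
      have n2 : i ≠ l := fun h => h3 (by rw [h, h2])
      have n3 : j ≠ k := fun h => h3 (by rw [h1, h])
      have n4 : j ≠ l := fun h => h3 (by rw [h1, h, h2])
      right
      dsimp only
      omega

theorem card_partitionArcs {m : ℕ} {V : Finpartition (Finset.univ : Finset (Fin m))}
    (hV : ∀ B ∈ V.parts, B.card ≤ 2) :
    (partitionArcs V).card = (V.parts.filter fun B => B.card = 2).card := by
  rw [partitionArcs, Finset.card_map]
  refine Finset.card_bij (fun p _ => V.part p.1) ?_ ?_ ?_
  · intro p hp
    rw [mem_blockPairs] at hp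
    have hmem : V.part p.1 ∈ V.parts := V.part_mem.2 (Finset.mem_univ _)
    refine Finset.mem_filter.2 ⟨hmem, le_antisymm (hV _ hmem) ?_⟩
    refine Finset.one_lt_card.2 ⟨p.1, ?_, p.2, ?_, hp.1.ne⟩
    · rw [V.mem_part_univ]
    · rw [V.mem_part_univ, hp.2]
  · intro p hp q hq h
    rw [mem_blockPairs] at hp hq
    obtain ⟨h1, h2⟩ := eq_of_part_eq_of_card_le_two hV hp.1 hq.1 hp.2 hq.2 h
    exact Prod.ext h1 h2
  · intro B hB
    obtain ⟨hB, hc⟩ := Finset.mem_filter.1 hB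
    obtain ⟨x, y, hxy, rfl⟩ := Finset.card_eq_two.1 hc
    have hx : V.part x = {x, y} := V.part_eq_of_mem hB (by simp)
    have hy : V.part y = {x, y} := V.part_eq_of_mem hB (by simp)
    rcases lt_or_gt_of_ne hxy with h | h
    · exact ⟨(x, y), mem_blockPairs.2 ⟨h, hx.trans hy.symm⟩, hx⟩
    · exact ⟨(y, x), mem_blockPairs.2 ⟨h, hy.trans hx.symm⟩, hy⟩

theorem singletonCount_add_two_mul_card {m : ℕ}
    {V : Finpartition (Finset.univ : Finset (Fin m))} (hV : ∀ B ∈ V.parts, B.card ≤ 2) :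
    V.parts.card = singletonCount V + (partitionArcs V).card ∧
      singletonCount V + 2 * (partitionArcs V).card = m := by
  have hfilter : (V.parts.filter fun B => B.card = 2) =
      V.parts.filter fun B => ¬ B.card = 1 := by
    refine Finset.filter_congr fun B hB => ?_
    have := hV B hB
    have := (V.nonempty_of_mem_parts hB).card_pos
    omega
  rw [card_partitionArcs hV, singletonCount]
  constructor
  · rw [hfilter, Finset.card_filter_add_card_filter_not]
  · have hsum := V.sum_card_parts
    rw [Finset.card_univ, Fintype.card_fin,
      ← Finset.sum_filter_add_sum_filter_not V.parts (fun B => B.card = 1), ← hfilter,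
      Finset.sum_const_nat (m := 1) (fun B hB => (Finset.mem_filter.1 hB).2),
      Finset.sum_const_nat (m := 2) (fun B hB => (Finset.mem_filter.1 hB).2)] at hsum
    omega

theorem partitionArcs_injective {m : ℕ} :
    Function.Injective (partitionArcs (m := m)) := by
  intro V W h
  have hlt : ∀ i j : Fin m, i < j → (V.part i = V.part j ↔ W.part i = W.part j) := by
    intro i j hij
    have := congrArg (fun A => (i, j) ∈ A) (Finset.map_injective _ h)
    simpa [mem_blockPairs, hij] using this
  have hpart : ∀ i, V.part i = W.part i := by
    intro i
    ext j
    rw [V.mem_part_univ, W.mem_part_univ]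
    rcases lt_trichotomy i j with hij | rfl | hij
    · rw [eq_comm, hlt i j hij, eq_comm]
    · simp
    · exact hlt j i hij
  ext B
  constructor
  · intro hB
    obtain ⟨i, hi⟩ := V.nonempty_of_mem_parts hB
    rw [← V.part_eq_of_mem hB hi, hpart]
    exact W.part_mem.2 (Finset.mem_univ _)
  · intro hB
    obtain ⟨i, hi⟩ := W.nonempty_of_mem_parts hB
    rw [← W.part_eq_of_mem hB hi, ← hpart]
    exact V.part_mem.2 (Finset.mem_univ _)

/-- The equivalence relation whose nontrivial classes are the arcs of an arc diagram. -/
def IsArcDiagram.setoid {m : ℕ} {A : Finset (ℕ × ℕ)} (hA : IsArcDiagram 0 m A) :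
    Setoid (Fin m) where
  r x y := x = y ∨ ((x : ℕ), (y : ℕ)) ∈ A ∨ ((y : ℕ), (x : ℕ)) ∈ A
  iseqv :=
    { refl := fun _ => Or.inl rfl
      symm := fun h => h.elim (fun h => Or.inl h.symm) fun h => Or.inr h.symm
      trans := by
        rintro x y z (rfl | h1 | h1) (rfl | h2 | h2)
        · exact Or.inl rfl
        · exact Or.inr (Or.inl h2)
        · exact Or.inr (Or.inr h2)
        · exact Or.inr (Or.inl h1)
        all_goals try exact Or.inr (Or.inr h1)
        all_goals
          have a1 := hA.1 _ h1
          have a2 := hA.1 _ h2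
          have a3 := hA.2 _ h1 _ h2
          simp only [Prod.mk.injEq] at a1 a2 a3
          left
          omega }

theorem exists_partitionArcs_eq {m : ℕ} {A : Finset (ℕ × ℕ)} (hA : IsArcDiagram 0 m A) :
    ∃ V : Finpartition (Finset.univ : Finset (Fin m)),
      IsNoncrossing V ∧ (∀ B ∈ V.parts, B.card ≤ 2) ∧ partitionArcs V = A := by
  classical
  let V := Finpartition.ofSetoid hA.setoid
  have hr : ∀ i j : Fin m, V.part i = V.part j ↔
      i = j ∨ ((i : ℕ), (j : ℕ)) ∈ A ∨ ((j : ℕ), (i : ℕ)) ∈ A := by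
    intro i j
    rw [eq_comm, ← V.mem_part_univ]
    exact Finpartition.mem_part_ofSetoid_iff_rel
  have hlt : ∀ i j : Fin m, i < j → V.part i = V.part j → ((i : ℕ), (j : ℕ)) ∈ A := by
    intro i j hij h
    rcases (hr i j).1 h with h | h | h
    · exact absurd h hij.ne
    · exact h
    · have := hA.1 _ h
      dsimp only at this
      omega
  refine ⟨V, ?_, ?_, ?_⟩
  · rintro ⟨i, k, j, l, hik, hkj, hjl, B, hB, C, hC, -, hi, hj, hk, hl⟩
    have h1 := hlt i j (hik.trans hkj)
      ((V.part_eq_of_mem hB hi).trans (V.part_eq_of_mem hB hj).symm)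
    have h2 := hlt k l (hkj.trans hjl)
      ((V.part_eq_of_mem hC hk).trans (V.part_eq_of_mem hC hl).symm)
    have := hA.2 _ h1 _ h2
    simp only [Prod.mk.injEq] at this
    omega
  · intro B hB
    by_contra! hc
    obtain ⟨x, hx, y, hy, z, hz, hxy, hxz, hyz⟩ := Finset.two_lt_card.1 hc
    have h1 := ((hr x y).1
      ((V.part_eq_of_mem hB hx).trans (V.part_eq_of_mem hB hy).symm)).resolve_left hxy
    have h2 := ((hr x z).1
      ((V.part_eq_of_mem hB hx).trans (V.part_eq_of_mem hB hz).symm)).resolve_left hxz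
    rcases h1 with h1 | h1 <;> rcases h2 with h2 | h2 <;>
    · have a1 := hA.1 _ h1
      have a2 := hA.1 _ h2
      have a3 := hA.2 _ h1 _ h2
      simp only [Prod.mk.injEq] at a1 a2 a3
      omega
  · ext ⟨x, y⟩
    rw [mem_partitionArcs]
    constructor
    · rintro ⟨i, j, hij, h, he⟩
      exact he ▸ hlt i j hij h
    · intro h
      have := hA.1 _ h
      dsimp only at this
      exact ⟨⟨x, by omega⟩, ⟨y, this.2.2⟩, this.2.1, (hr _ _).2 (Or.inr (Or.inl h)), rfl⟩

/-- **Free cumulants of the free Gamma law `μ_{2a,a²}`.** For every `m ≥ 0`,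
`∑_{V ∈ NC_{≤2}(m)} (2a)^{s(V)} (a²)^{|V|-s(V)} = (1/(m+2)) binom(2m+2, m+1) aᵐ`,
i.e. the free cumulants of the standardized free Gamma type law `μ_{2a,a²}` are
`R_{k+1} = (1/(k+1)) binom(2k,k) a^{k-1}` for `k ≥ 1`. -/
theorem stmt_17 (m : ℕ) (a : ℝ) :
    (∑ᶠ V ∈ {V : Finpartition (Finset.univ : Finset (Fin m)) |
        IsNoncrossing V ∧ ∀ B ∈ V.parts, B.card ≤ 2},
      (2 * a) ^ singletonCount V * (a ^ 2) ^ (V.parts.card - singletonCount V))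
      = (1 / ((m : ℝ) + 2)) * (Nat.choose (2 * m + 2) (m + 1)) * a ^ m := by
  classical
  have hsum : (∑ᶠ V ∈ {V : Finpartition (Finset.univ : Finset (Fin m)) |
        IsNoncrossing V ∧ ∀ B ∈ V.parts, B.card ≤ 2},
      (2 * a) ^ singletonCount V * (a ^ 2) ^ (V.parts.card - singletonCount V))
      = arcDiagramSum 0 m * a ^ m := by
    rw [finsum_mem_eq_toFinset_sum, arcDiagramSum, Finset.sum_mul]
    refine Finset.sum_bij (fun V _ => partitionArcs V) ?_ ?_ ?_ ?_
    · intro V hV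
      rw [Set.mem_toFinset] at hV
      exact mem_arcDiagrams.2 (isArcDiagram_partitionArcs hV.1 hV.2)
    · intro V _ W _ h
      exact partitionArcs_injective h
    · intro A hA
      obtain ⟨V, h1, h2, h3⟩ := exists_partitionArcs_eq (mem_arcDiagrams.1 hA)
      exact ⟨V, Set.mem_toFinset.2 ⟨h1, h2⟩, h3⟩
    · intro V hV
      rw [Set.mem_toFinset] at hV
      obtain ⟨h1, h2⟩ := singletonCount_add_two_mul_card hV.2
      rw [h1, Nat.add_sub_cancel_left, Nat.sub_zero]
      generalize singletonCount V = s at h2 ⊢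
      generalize (partitionArcs V).card = p at h2 ⊢
      have h4 : (2 : ℝ) ^ (2 * p) * (1 / 4) ^ p = 1 := by
        rw [pow_mul, ← mul_pow]
        norm_num
      rw [← h2, pow_add, pow_add, mul_pow, ← pow_mul]
      linear_combination (-(2 : ℝ) ^ s * a ^ s * a ^ (2 * p)) * h4
  have hcat : ((m : ℝ) + 2) * catalan (m + 1) = Nat.choose (2 * m + 2) (m + 1) := by
    have := succ_mul_catalan_eq_centralBinom (m + 1)
    rw [Nat.centralBinom_eq_two_mul_choose, show 2 * (m + 1) = 2 * m + 2 by ring] at this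
    rw [← this]
    push_cast
    ring
  have hm : (m : ℝ) + 2 ≠ 0 := by positivity
  have hval := arcDiagramSum_eq_catalan 0 m
  rw [Nat.zero_add] at hval
  rw [hsum, hval, ← hcat]
  field_simp
end
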